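/- Let $K$ be a field of characteristic zero. A commutative dendriform trialgebra $(A,\cdot,\vartriangleright)$ over $K$ is a $K$-vector space $A$ with two bilinear operations $\cdot$ and $\vartriangleright$ such that $(A,\cdot)$ is a (not necessarily unital) commutative associative algebra and, for all $x,y,z\in A$, $$(x\vartriangleright y+y\vartriangleright x+x\cdot y)\vartriangleright z=x\vartriangleright(y\vartriangleright z),\qquad (x\vartriangleright y)\cdot z=x\vartriangleright(y\cdot z).$$ Let $(A,\cdot,\vartriangleright)$ be a commutative dendriform trialgebra over $K$. Then the product $x\circ y=x\vartriangleright y+y\vartriangleright x+x\cdot y$ defines a commutative associative algebra structure on $A$ (the sub-adjacent commutative associative algebra $A^C$). Moreover, the linear map $L_\vartriangleright:A\to\operatorname{End}(A)$, $L_\vartriangleright(x)y=x\vartriangleright y$, makes $(A,\cdot)$ an $A^C$-module commutative associative algebra, i.e. $L_\vartriangleright(x\circ y)=L_\vartriangleright(x)L_\vartriangleright(y)$ and $L_\vartriangleright(x)(a\cdot b)=(L_\vartriangleright(x)a)\cdot b$ for all $x,y,a,b\in A$. -/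

import Mathlib

section CommDendriform

variable {K A V : Type*} [Field K] [AddCommGroup A] [Module K A] [AddCommGroup V] [Module K V]

/-- The bilinear product `m` makes `A` a (not necessarily unital) commutative associative
`K`-algebra. -/
structure IsCommAssoc (m : A →ₗ[K] A →ₗ[K] A) : Prop where
  comm : ∀ x y, m x y = m y x
  assoc : ∀ x y z, m (m x y) z = m x (m y z)

/-- `(V, μ)` is a representation of the algebra `(A, m)`: `μ (x y) = μ x ∘ μ y` in `End V`. -/
def IsRepresentation (m : A →ₗ[K] A →ₗ[K] A) (μ : A →ₗ[K] Module.End K V) : Prop :=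
  ∀ x y, μ (m x y) = μ x * μ y

/-- `(V, mV, μ)` is a module commutative associative algebra over the commutative associative
algebra `(A, m)`. -/
structure IsModuleCommAssoc (m : A →ₗ[K] A →ₗ[K] A) (mV : V →ₗ[K] V →ₗ[K] V)
    (μ : A →ₗ[K] Module.End K V) : Prop where
  base : IsCommAssoc m
  alg : IsCommAssoc mV
  rep : IsRepresentation m μ
  compat : ∀ x a b, μ x (mV a b) = mV (μ x a) b

/-- The product `x ∘ y = x ▷ y + y ▷ x + x · y`, where `m` is `·` and `tr` is `▷`. -/
def subAdjacent (m tr : A →ₗ[K] A →ₗ[K] A) : A →ₗ[K] A →ₗ[K] A :=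
  tr + tr.flip + m

theorem subAdjacent_apply (m tr : A →ₗ[K] A →ₗ[K] A) (x y : A) :
    subAdjacent m tr x y = tr x y + tr y x + m x y := rfl

/-- A commutative dendriform trialgebra `(A, ·, ▷)`, where `m` is `·` and `tr` is `▷`. -/
structure IsCommDendriformTrialgebra (m tr : A →ₗ[K] A →ₗ[K] A) : Prop where
  commAssoc : IsCommAssoc m
  tr_tr : ∀ x y z, tr (tr x y + tr y x + m x y) z = tr x (tr y z)
  tr_mul : ∀ x y z, m (tr x y) z = tr x (m y z)

/-- The linear map `L_▷ : A → End A`, `L_▷ x y = x ▷ y`. -/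
def leftTr (tr : A →ₗ[K] A →ₗ[K] A) : A →ₗ[K] Module.End K A := tr

theorem leftTr_apply (tr : A →ₗ[K] A →ₗ[K] A) (x y : A) : leftTr tr x y = tr x y := rfl

end CommDendriform

namespace IsCommDendriformTrialgebra

variable {K A : Type*} [Field K] [AddCommGroup A] [Module K A] {m tr : A →ₗ[K] A →ₗ[K] A}

theorem tr_left_comm (h : IsCommDendriformTrialgebra m tr) (x y z : A) :
    tr x (tr y z) = tr y (tr x z) := by
  rw [← h.tr_tr, ← h.tr_tr, h.commAssoc.comm x y, add_comm (tr x y)]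

theorem mul_tr (h : IsCommDendriformTrialgebra m tr) (x y z : A) :
    m x (tr y z) = tr y (m x z) := by
  rw [h.commAssoc.comm, h.tr_mul, h.commAssoc.comm z]

theorem isCommAssoc_subAdjacent (h : IsCommDendriformTrialgebra m tr) :
    IsCommAssoc (subAdjacent m tr) where
  comm x y := by
    rw [subAdjacent_apply, subAdjacent_apply, h.commAssoc.comm x y, add_comm (tr x y)]
  assoc x y z := by
    simp only [subAdjacent_apply]
    rw [h.tr_tr x y z, h.tr_tr y z x]
    simp only [map_add, LinearMap.add_apply, h.tr_mul, h.mul_tr, h.commAssoc.assoc]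
    rw [h.tr_left_comm z x y, h.tr_left_comm z y x]
    abel

theorem isModuleCommAssoc_leftTr (h : IsCommDendriformTrialgebra m tr) :
    IsModuleCommAssoc (subAdjacent m tr) m (leftTr tr) where
  base := h.isCommAssoc_subAdjacent
  alg := h.commAssoc
  rep x y := LinearMap.ext fun z => h.tr_tr x y z
  compat x a b := (h.tr_mul x a b).symm

end IsCommDendriformTrialgebra

theorem stmt7 {K A : Type*} [Field K] [CharZero K] [AddCommGroup A] [Module K A]
    (m tr : A →ₗ[K] A →ₗ[K] A) (h : IsCommDendriformTrialgebra m tr) :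
    IsCommAssoc (subAdjacent m tr) ∧
      IsModuleCommAssoc (subAdjacent m tr) m (leftTr tr) :=
  ⟨h.isCommAssoc_subAdjacent, h.isModuleCommAssoc_leftTr⟩
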